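/- arXiv:1701.07735 — 5 statements merged into one kernel-verified Lean document; each statement's English description precedes it below -/
import Mathlib

section
/- If M is a finitely generated flat module over a commutative ring R, then for each n the n-th invariant factor I_n(M) = Ann_R(\Lambda^n M) is an idempotent ideal. -/
namespace InvFactor

variable {R : Type*} [CommRing R]

/-- A multilinear (alternating) map vanishing as soon as one argument is in `K` only depends
on the arguments modulo `K`. -/
theorem congr_of_sub_mem {F Q : Type*} [AddCommGroup F] [Module R F] [AddCommGroup Q] [Module R Q]
    {n : ℕ} (g : F [⋀^Fin n]→ₗ[R] Q) (K : Submodule R F)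
    (hg : ∀ v i, v i ∈ K → g v = 0) (v w : Fin n → F) (h : ∀ i, v i - w i ∈ K) : g v = g w := by
  have key : ∀ s : Finset (Fin n), g (s.piecewise v w) = g w := by
    intro s
    induction s using Finset.induction_on with
    | empty => simp
    | insert i s hi ih =>
      rw [← ih, Finset.piecewise_insert]
      have h1 : s.piecewise v w = Function.update (s.piecewise v w) i (w i) := by
        rw [eq_comm, Function.update_eq_self_iff]
        simp [hi]
      conv_rhs => rw [h1]
      rw [← sub_eq_zero, ← AlternatingMap.map_update_sub]
      exact hg _ i (by simpa using h i)
  simpa using key Finset.univ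

/-- Descent of an alternating map along a surjection. -/
theorem exists_descent {F M Q : Type*} [AddCommGroup F] [Module R F] [AddCommGroup M] [Module R M]
    [AddCommGroup Q] [Module R Q] {n : ℕ} (φ : F →ₗ[R] M) (hφ : Function.Surjective φ)
    (g : F [⋀^Fin n]→ₗ[R] Q) (hg : ∀ v i, φ (v i) = 0 → g v = 0) :
    ∃ g' : M [⋀^Fin n]→ₗ[R] Q, ∀ v, g' (fun i => φ (v i)) = g v := by
  obtain ⟨s, hs⟩ := hφ.hasRightInverse
  have hc := congr_of_sub_mem g (LinearMap.ker φ) (fun v i h => hg v i h)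
  refine ⟨{ toFun := fun m => g (fun i => s (m i))
            map_update_add' := ?_
            map_update_smul' := ?_
            map_eq_zero_of_eq' := ?_ }, ?_⟩
  · intro _ m i x y
    have := g.map_update_add (fun j => s (m j)) i (s x) (s y)
    convert this using 1
    · apply hc
      intro j
      by_cases hj : j = i
      · subst hj; simp [hs _]
      · simp [hj]
    · congr 1 <;> (apply hc; intro j; by_cases hj : j = i
                   · subst hj; simp
                   · simp [hj])
  · intro _ m i c x
    have := g.map_update_smul (fun j => s (m j)) i c (s x)
    convert this using 1
    · apply hc
      intro j
      by_cases hj : j = i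
      · subst hj; simp [hs _]
      · simp [hj]
    · congr 1
      apply hc; intro j; by_cases hj : j = i
      · subst hj; simp
      · simp [hj]
  · intro m i j h hij
    exact g.map_eq_zero_of_eq _ (by simp [h]) hij
  · intro v
    apply hc
    intro i
    simp [hs _]

/-- The kernel of the map induced on exterior powers by a surjection. -/
theorem mem_span_of_map_eq_zero {F M : Type*} [AddCommGroup F] [Module R F] [AddCommGroup M]
    [Module R M] {n : ℕ} (φ : F →ₗ[R] M) (hφ : Function.Surjective φ) (z : ⋀[R]^n F)
    (hz : exteriorPower.map n φ z = 0) :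
    z ∈ Submodule.span R {t : ⋀[R]^n F | ∃ v : Fin n → F, (∃ i, φ (v i) = 0) ∧
      exteriorPower.ιMulti R n v = t} := by
  set N := Submodule.span R {t : ⋀[R]^n F | ∃ v : Fin n → F, (∃ i, φ (v i) = 0) ∧
      exteriorPower.ιMulti R n v = t} with hN
  obtain ⟨g', hg'⟩ := exists_descent φ hφ (N.mkQ.compAlternatingMap (exteriorPower.ιMulti R n))
    (by
      intro v i h
      simp only [LinearMap.compAlternatingMap_apply, Submodule.mkQ_apply,
        Submodule.Quotient.mk_eq_zero]
      exact Submodule.subset_span ⟨v, ⟨i, h⟩, rfl⟩)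
  have h : exteriorPower.alternatingMapLinearEquiv g' ∘ₗ exteriorPower.map n φ = N.mkQ := by
    apply exteriorPower.linearMap_ext
    ext v
    simpa [Function.comp_def] using hg' v
  have h2 := LinearMap.congr_fun h z
  rw [LinearMap.comp_apply, hz, map_zero, eq_comm, Submodule.mkQ_apply,
    Submodule.Quotient.mk_eq_zero] at h2
  exact h2

theorem mem_smul_top {M : Type*} [AddCommGroup M] [Module R M]
    [Module.Finite R M] [Module.Flat R M] (n : ℕ) (a : R) (x : ⋀[R]^n M) (hx : a • x = 0) :
    x ∈ Module.annihilator R (Submodule.span R {a}) • (⊤ : Submodule R (⋀[R]^n M)) := by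
  obtain ⟨k, φ, hφ⟩ := Module.Finite.exists_fin' R M
  obtain ⟨y, rfl⟩ := exteriorPower.map_surjective hφ x
  have hz := mem_span_of_map_eq_zero φ hφ (a • y) (by rw [map_smul, hx])
  obtain ⟨T, hT, hzT⟩ := Submodule.mem_span_finite_of_mem_span hz
  have hT' : ∀ t : T, ∃ v : Fin n → Fin k → R, (∃ i, φ (v i) = 0) ∧
      exteriorPower.ιMulti R n v = t := fun t => hT t.2
  choose V hV hVt using hT'
  choose i hi using hV
  let f : (T →₀ R) →ₗ[R] (Fin k → R) :=
    Finsupp.linearCombination R (fun t : T => V t (i t))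
  have hf : φ ∘ₗ f = 0 := by
    ext t
    simpa [f] using hi t
  obtain ⟨l, θ, ψ, rfl, hθ⟩ := Module.Flat.exists_factorization_of_comp_eq_zero_of_free hf
  have hker : Submodule.span R (T : Set (⋀[R]^n (Fin k → R))) ≤
      LinearMap.ker (exteriorPower.map n θ) := by
    rw [Submodule.span_le]
    intro t ht
    have h0 : θ (V ⟨t, ht⟩ (i ⟨t, ht⟩)) = 0 := by
      have := LinearMap.congr_fun hθ (Finsupp.single ⟨t, ht⟩ 1)
      simpa [f] using this
    simp only [SetLike.mem_coe, LinearMap.mem_ker]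
    have h1 : exteriorPower.ιMulti R n (V ⟨t, ht⟩) = t := hVt ⟨t, ht⟩
    rw [← h1, exteriorPower.map_apply_ιMulti]
    exact AlternatingMap.map_coord_zero _ (i ⟨t, ht⟩) h0
  have h0 : a • exteriorPower.map n θ y = 0 := by
    rw [← map_smul]; exact hker hzT
  rw [exteriorPower.map_comp, LinearMap.comp_apply]
  let b := Module.Free.chooseBasis R (⋀[R]^n (Fin l →₀ R))
  generalize exteriorPower.map n θ y = w at h0 ⊢
  rw [← b.linearCombination_repr w, Finsupp.linearCombination_apply, Finsupp.sum, map_sum]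
  refine Submodule.sum_mem _ fun j _ => ?_
  rw [map_smul]
  refine Submodule.smul_mem_smul ?_ trivial
  have h3 : a * b.repr w j = 0 := by
    have := congrArg (fun u => b.repr u j) h0
    simpa using this
  rw [Submodule.mem_annihilator_span_singleton, smul_eq_mul, mul_comm, h3]

end InvFactor

/-- The invariant factors (annihilators of exterior powers) of a finitely
generated flat module are idempotent ideals. -/
theorem invariantFactor_idempotent_of_fg_flat
    (R M : Type*) [CommRing R] [AddCommGroup M] [Module R M]
    [Module.Finite R M] [Module.Flat R M] (n : ℕ) :
    Module.annihilator R (⋀[R]^n M) * Module.annihilator R (⋀[R]^n M) =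
      Module.annihilator R (⋀[R]^n M) := by
  refine le_antisymm Ideal.mul_le_left fun a ha => ?_
  obtain ⟨r, hr, hr0⟩ := Submodule.exists_sub_one_mem_and_smul_eq_zero_of_fg_of_le_smul
    (Module.annihilator R (Submodule.span R {a})) (⊤ : Submodule R (⋀[R]^n M))
    Module.Finite.fg_top
    (fun x _ => InvFactor.mem_smul_top n a x (Module.mem_annihilator.mp ha x))
  rw [Submodule.mem_annihilator_span_singleton, smul_eq_mul] at hr
  have h : a = a * r := by linear_combination -hr
  rw [h]
  exact Ideal.mul_mem_mul ha (Module.mem_annihilator.mpr fun x => hr0 x trivial)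
end

section
/- Let M be a finitely generated flat module over a commutative ring R. Then M is projective if and only if for each n \geq 1 the invariant factor I_n(M) = Ann_R(\Lambda^n M) is a finitely generated ideal. -/
open Module in
/-- The annihilator of a finitely generated projective module is finitely generated. -/
lemma aux_ann_fg_of_projective (R P : Type*) [CommRing R] [AddCommGroup P] [Module R P]
    [Module.Finite R P] [Module.Projective R P] : (Module.annihilator R P).FG := by
  obtain ⟨s, hs⟩ := Module.projective_def'.1 (inferInstance : Module.Projective R P)
  let T : Ideal R := Ideal.span {r | ∃ (f : P →ₗ[R] R) (m : P), f m = r}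
  have hT : (⊤ : Submodule R P) ≤ T • ⊤ := by
    intro m _
    have h := LinearMap.congr_fun hs m
    simp only [LinearMap.comp_apply, LinearMap.id_apply, Finsupp.linearCombination_apply,
      Finsupp.sum, id] at h
    rw [← h]
    refine Submodule.sum_mem _ fun i _ => Submodule.smul_mem_smul ?_ trivial
    exact Ideal.subset_span ⟨(Finsupp.lapply i).comp s, m, rfl⟩
  obtain ⟨r, hr1, hr2⟩ :=
    Submodule.exists_sub_one_mem_and_smul_eq_zero_of_fg_of_le_smul T ⊤ Module.Finite.fg_top hT
  have hann : ∀ x ∈ Module.annihilator R P, ∀ t ∈ T, x * t = 0 := by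
    intro x hx t ht
    induction ht using Submodule.span_induction with
    | mem t ht =>
      obtain ⟨f, m, rfl⟩ := ht
      rw [← smul_eq_mul, ← map_smul, Module.mem_annihilator.1 hx m, map_zero]
    | zero => simp
    | add a b _ _ ha hb => rw [mul_add, ha, hb, add_zero]
    | smul a b _ hb => rw [smul_eq_mul, mul_left_comm, hb, mul_zero]
  refine ⟨{r}, le_antisymm ?_ ?_⟩
  · rw [Submodule.span_le]
    simpa [Module.mem_annihilator] using fun m => hr2 m trivial
  · intro x hx
    have := hann x hx _ hr1
    rw [Finset.coe_singleton]
    refine Submodule.mem_span_singleton.2 ⟨x, ?_⟩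
    rw [smul_eq_mul]
    linear_combination this

lemma aux_projective_exteriorPower (R M : Type*) [CommRing R] [AddCommGroup M] [Module R M]
    [Module.Projective R M] (n : ℕ) : Module.Projective R (⋀[R]^n M) := by
  obtain ⟨s, hs⟩ := Module.projective_def'.1 (inferInstance : Module.Projective R M)
  refine Module.Projective.of_split (exteriorPower.map n s)
    (exteriorPower.map n (Finsupp.linearCombination R id)) ?_
  rw [← exteriorPower.map_comp, hs, exteriorPower.map_id]

attribute [local instance] Module.free_of_flat_of_isLocalRing

/-- If `n ≤ rank_p M`, then the annihilator of the `n`-th exterior power vanishes at `p`. -/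
lemma aux_ann_eq_zero (R M : Type*) [CommRing R] [AddCommGroup M] [Module R M]
    [Module.Finite R M] [Module.Flat R M] (n : ℕ) (p : PrimeSpectrum R)
    (hn : n ≤ Module.rankAtStalk M p) (r : R) (hr : r ∈ Module.annihilator R (⋀[R]^n M)) :
    algebraMap R (Localization.AtPrime p.asIdeal) r = 0 := by
  let A := Localization.AtPrime p.asIdeal
  let N := LocalizedModule p.asIdeal.primeCompl M
  let g : M →ₗ[R] N := LocalizedModule.mkLinearMap p.asIdeal.primeCompl M
  let G : M [⋀^Fin n]→ₗ[R] (⋀[A]^n N) :=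
    { ((exteriorPower.ιMulti A n (M := N)).toMultilinearMap.restrictScalars R).compLinearMap
        (fun _ => g) with
      map_eq_zero_of_eq' := fun v i j hij hne =>
        (exteriorPower.ιMulti A n (M := N)).map_eq_zero_of_eq (fun i => g (v i))
          (congrArg g hij) hne }
  have hspan : Submodule.span A (Set.range g) = ⊤ :=
by
    have := span_eq_top_of_isLocalizedModule A p.asIdeal.primeCompl g (v := Set.univ) (by simp)
    rwa [Set.image_univ] at this
  have h1 := exteriorPower.ιMulti_span_of_span (R := A) (n := n) (M := N) (hs := hspan)
  have h2 : ∀ x : ⋀[A]^n N, algebraMap R A r • x = 0 := by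
    intro x
    have hx : x ∈ (⊤ : Submodule A (⋀[A]^n N)) := trivial
    rw [← h1] at hx
    induction hx using Submodule.span_induction with
    | mem t ht =>
      obtain ⟨v, hv, rfl⟩ := ht
      choose w hw using fun i => hv (Set.mem_range_self i)
      have hvw : v = fun i => g (w i) := by
        funext i
        exact (hw i).symm
      have hG : exteriorPower.alternatingMapLinearEquiv G (exteriorPower.ιMulti R n w) =
          exteriorPower.ιMulti A n v := by
        rw [exteriorPower.alternatingMapLinearEquiv_apply_ιMulti, hvw]
        rfl
      rw [← hG, algebraMap_smul, ← map_smul, Module.mem_annihilator.1 hr, map_zero]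
    | zero => simp
    | add a b _ _ ha hb => rw [smul_add, ha, hb, add_zero]
    | smul a b _ hb => rw [smul_comm, hb, smul_zero]
  have h3 : 0 < Module.finrank A (⋀[A]^n N) := by
    rw [exteriorPower.finrank_eq]
    exact Nat.choose_pos hn
  have : Nontrivial (⋀[A]^n N) := Module.nontrivial_of_finrank_pos h3
  let b := Module.finBasis A (⋀[A]^n N)
  have h4 := congrArg (fun x => b.repr x ⟨0, h3⟩) (h2 (b ⟨0, h3⟩))
  simpa only [map_smul, Finsupp.smul_apply, Module.Basis.repr_self, Finsupp.single_eq_same,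
    smul_eq_mul, mul_one, map_zero, Finsupp.zero_apply] using h4

/-- Approximate a basis at `p` -/
lemma aux_exists_map (R M : Type*) [CommRing R] [AddCommGroup M] [Module R M]
    [Module.Finite R M] [Module.Flat R M] (p : PrimeSpectrum R) :
    ∃ (φ : (Fin (Module.rankAtStalk M p) →₀ R) →ₗ[R] M) (s : R), s ∉ p.asIdeal ∧
      ∀ m : M, s • m ∈ LinearMap.range φ := by
  let Rₚ := Localization.AtPrime p.asIdeal
  let n := Module.rankAtStalk M p
  let f : (Fin n →₀ R) →ₗ[R] Fin n →₀ Rₚ := Finsupp.mapRange.linearMap (Algebra.linearMap R Rₚ)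
  let g : M →ₗ[R] LocalizedModule.AtPrime p.asIdeal M :=
    LocalizedModule.mkLinearMap p.asIdeal.primeCompl M
  obtain ⟨φ, -, -, hφps⟩ := Module.exists_localizedMap_surjective_of_surjective
    p.asIdeal.primeCompl f g
      ((Module.finBasis Rₚ (LocalizedModule.AtPrime p.asIdeal M)).repr.restrictScalars R).symm.surjective
  have h : Function.Surjective (LocalizedModule.map p.asIdeal.primeCompl φ) := by
    simpa [LocalizedModule.coe_map_eq f g]
  rw [φ.localizedMap_surjective_iff_subsingleton_localized_coker] at h
  have h' := Module.notMem_support_iff.2 h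
  rw [Module.support_eq_zeroLocus, PrimeSpectrum.mem_zeroLocus, Set.not_subset] at h'
  obtain ⟨s, hs, hsp⟩ := h'
  refine ⟨φ, s, hsp, fun m => ?_⟩
  have := Module.mem_annihilator.1 hs (Submodule.Quotient.mk m)
  rwa [← Submodule.Quotient.mk_smul, Submodule.Quotient.mk_eq_zero] at this

lemma aux_exists_mem_ann (R M : Type*) [CommRing R] [AddCommGroup M] [Module R M]
    [Module.Finite R M] [Module.Flat R M] (n : ℕ) (p : PrimeSpectrum R)
    (hn : Module.rankAtStalk M p < n) :
    ∃ s ∉ p.asIdeal, s ∈ Module.annihilator R (⋀[R]^n M) := by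
  have : Nontrivial R := p.nontrivial
  obtain ⟨φ, s, hs, H⟩ := aux_exists_map R M p
  have hsub : Subsingleton (⋀[R]^n (Fin (Module.rankAtStalk M p) →₀ R)) := by
    rw [← Module.finrank_eq_zero_iff_of_free (R := R), exteriorPower.finrank_eq]
    simpa using Nat.choose_eq_zero_of_lt hn
  refine ⟨s ^ n, fun h => hs (p.2.mem_of_pow_mem _ h), ?_⟩
  rw [Module.mem_annihilator]
  intro x
  have hx : x ∈ (⊤ : Submodule R (⋀[R]^n M)) := trivial
  rw [← exteriorPower.ιMulti_span] at hx
  induction hx using Submodule.span_induction with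
  | mem t ht =>
    obtain ⟨v, rfl⟩ := ht
    choose w hw using fun i => H (v i)
    have h1 := (exteriorPower.ιMulti R n (M := M)).map_smul_univ (fun _ => s) v
    have h2 := exteriorPower.map_apply_ιMulti (n := n) φ w
    rw [Subsingleton.elim (exteriorPower.ιMulti R n w) 0, map_zero] at h2
    simp only [Finset.prod_const, Finset.card_univ, Fintype.card_fin] at h1
    rw [← h1, h2]
    congr 1
    ext i
    exact (hw i).symm
  | zero => simp
  | add a b _ _ ha hb => rw [smul_add, ha, hb, add_zero]
  | smul a b _ hb => rw [smul_comm, hb, smul_zero]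

lemma aux_idempotent (R M : Type*) [CommRing R] [AddCommGroup M] [Module R M]
    [Module.Finite R M] [Module.Flat R M] (n : ℕ) :
    IsIdempotentElem (Module.annihilator R (⋀[R]^n M)) := by
  refine le_antisymm Ideal.mul_le_left fun r hr => ?_
  set I := Module.annihilator R (⋀[R]^n M)
  let J : Ideal R := Submodule.colon (I * I) {r}
  have hJ : J = ⊤ := by
    by_contra hne
    obtain ⟨m, hm, hle⟩ := J.exists_le_maximal hne
    rcases le_or_gt n (Module.rankAtStalk M (⟨m, hm.isPrime⟩ : PrimeSpectrum R)) with h | h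
    · have h0 := aux_ann_eq_zero R M n ⟨m, hm.isPrime⟩ h r hr
      obtain ⟨⟨s, hs⟩, h0⟩ := (IsLocalization.map_eq_zero_iff m.primeCompl _ r).1 h0
      refine hs (hle (Submodule.mem_colon_singleton.2 ?_))
      simp only at h0
      rw [smul_eq_mul, h0]
      exact zero_mem _
    · obtain ⟨s, hs, hsI⟩ := aux_exists_mem_ann R M n ⟨m, hm.isPrime⟩ h
      exact hs (hle (Submodule.mem_colon_singleton.2 (Ideal.mul_mem_mul hsI hr)))
  have h1 : (1 : R) ∈ J := hJ ▸ trivial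
  simpa using Submodule.mem_colon_singleton.1 h1

lemma aux_fp_of_local (R M : Type*) [CommRing R] [AddCommGroup M] [Module R M]
    (h : ∀ p : PrimeSpectrum R, ∃ a ∉ p.asIdeal,
      Module.FinitePresentation (Localization.Away a) (LocalizedModule.Away a M)) :
    Module.FinitePresentation R M := by
  refine Module.FinitePresentation.of_localizationSpan
    {a : R | Module.FinitePresentation (Localization.Away a) (LocalizedModule.Away a M)} ?_
    fun g => g.2
  by_contra hne
  obtain ⟨m, hm, hle⟩ := Ideal.exists_le_maximal _ hne
  obtain ⟨a, ha, hfp⟩ := h ⟨m, hm.isPrime⟩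
  exact ha (hle (Ideal.subset_span hfp))

lemma aux_fp_of_const (R M : Type*) [CommRing R] [AddCommGroup M] [Module R M]
    [Module.Finite R M] [Module.Flat R M] (n : ℕ)
    (h : ∀ p : PrimeSpectrum R, Module.rankAtStalk M p = n) :
    Module.FinitePresentation R M := by
  refine aux_fp_of_local R M fun p => ?_
  obtain ⟨a, ha, hfree⟩ := Module.Free.away_of_finite_of_flat_of_rankAtStalk_constant M p.asIdeal
    (fun m _ => by rw [h, h])
  have : Module.Finite (Localization.Away a) (LocalizedModule.Away a M) :=
    inferInstanceAs (Module.Finite (Localization (Submonoid.powers a))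
      (LocalizedModule (Submonoid.powers a) M))
  exact ⟨a, ha, Module.finitePresentation_of_projective _ _⟩

lemma aux_projective (R M : Type*) [CommRing R] [AddCommGroup M] [Module R M]
    [Module.Finite R M] [Module.Flat R M]
    (H : ∀ n : ℕ, (Module.annihilator R (⋀[R]^n M)).FG) : Module.Projective R M := by
  have he : ∀ n, ∃ e : R, IsIdempotentElem e ∧
      Module.annihilator R (⋀[R]^n M) = Ideal.span {e} := fun n =>
    (Ideal.isIdempotentElem_iff_of_fg _ (H n)).1 (aux_idempotent R M n)
  choose e he hI using he
  have h1 : ∀ n (p : PrimeSpectrum R), n ≤ Module.rankAtStalk M p → e n ∈ p.asIdeal := by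
    intro n p h
    have := aux_ann_eq_zero R M n p h (e n) (by rw [hI]; exact Ideal.mem_span_singleton_self _)
    obtain ⟨⟨s, hs⟩, h0⟩ := (IsLocalization.map_eq_zero_iff p.asIdeal.primeCompl _ _).1 this
    exact (p.2.mem_or_mem (h0 ▸ zero_mem _ : s * e n ∈ p.asIdeal)).resolve_left hs
  have h2 : ∀ n (p : PrimeSpectrum R), Module.rankAtStalk M p < n → e n ∉ p.asIdeal := by
    intro n p h hmem
    obtain ⟨s, hs, hsI⟩ := aux_exists_mem_ann R M n p h
    rw [hI] at hsI
    exact hs ((Ideal.span_singleton_le_iff_mem _).2 hmem hsI)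
  have : Module.FinitePresentation R M := by
    refine aux_fp_of_local R M fun p => ?_
    set n := Module.rankAtStalk M p with hn
    refine ⟨e (n + 1) * (1 - e n), ?_, ?_⟩
    · intro hmem
      rcases p.2.mem_or_mem hmem with h | h
      · exact h2 (n + 1) p (by omega) h
      · refine p.2.one_notMem ?_
        simpa using add_mem h (h1 n p le_rfl)
    · set f := e (n + 1) * (1 - e n) with hf
      refine aux_fp_of_const _ _ n fun q => ?_
      rw [Module.rankAtStalk_isBaseChange
        (LocalizedModule.isBaseChange (Submonoid.powers f) M)]
      set q' := q.comap (algebraMap R (Localization.Away f))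
      have hfq : f ∉ q'.asIdeal := fun hmem => by
        have hu : IsUnit (algebraMap R (Localization.Away f) f) :=
          IsLocalization.Away.algebraMap_isUnit f
        exact q.2.ne_top (Ideal.eq_top_of_isUnit_mem _ hmem hu)
      apply le_antisymm
      · by_contra hlt
        exact hfq (Ideal.mul_mem_right _ _ (h1 (n + 1) q' (by omega)))
      · by_contra hlt
        have h3 := h2 n q' (by omega)
        refine hfq (Ideal.mul_mem_left _ _ ?_)
        refine (q'.2.mem_or_mem (?_ : e n * (1 - e n) ∈ q'.asIdeal)).resolve_left h3
        have := (he n).eq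
        rw [mul_sub, mul_one, this, sub_self]
        exact zero_mem _
  exact Module.Flat.projective_of_finitePresentation

/-- A finitely generated flat module is projective iff all its invariant factors
(annihilators of exterior powers) are finitely generated ideals. -/
theorem projective_iff_invariantFactors_fg
    (R M : Type*) [CommRing R] [AddCommGroup M] [Module R M]
    [Module.Finite R M] [Module.Flat R M] :
    Module.Projective R M ↔
      ∀ n : ℕ, 1 ≤ n → (Module.annihilator R (⋀[R]^n M)).FG := by
  constructor
  · intro h n _
    have := aux_projective_exteriorPower R M n
    exact aux_ann_fg_of_projective R _
  · intro h
    refine aux_projective R M fun n => ?_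
    rcases Nat.eq_zero_or_pos n with rfl | hn
    · have : Module.Projective R (⋀[R]^0 M) :=
        Module.Projective.of_equiv (exteriorPower.zeroEquiv R M).symm
      exact aux_ann_fg_of_projective R _
    · exact h n hn
end

section
/- Let M be a finitely generated flat module over a commutative ring R and J an ideal contained in the Jacobson radical of R. If M/JM is projective as an R/J-module, then M is projective as an R-module. -/
/-- If `J` is an ideal contained in the Jacobson radical and `M` is a finitely
generated flat `R`-module with `M/JM` projective over `R/J`, then `M` is
projective over `R`. -/
theorem projective_of_quotient_projective
    (R M : Type*) [CommRing R] [AddCommGroup M] [Module R M]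
    [Module.Finite R M] [Module.Flat R M] (J : Ideal R)
    (hJ : J ≤ Ideal.jacobson ⊥)
    (h : Module.Projective (R ⧸ J) (M ⧸ (J • ⊤ : Submodule R M))) :
    Module.Projective R M := by
  obtain ⟨n, π, hπ⟩ := Module.Finite.exists_fin' R M
  have hmap : Submodule.map π (J • ⊤ : Submodule R (Fin n → R)) = J • ⊤ := by
    rw [Submodule.map_smul'', Submodule.map_top, LinearMap.range_eq_top.2 hπ]
  let p : ((Fin n → R) ⧸ (J • ⊤ : Submodule R (Fin n → R))) →ₗ[R]
      (M ⧸ (J • ⊤ : Submodule R M)) :=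
    Submodule.mapQ _ _ π (Submodule.map_le_iff_le_comap.1 hmap.le)
  have hp : Function.Surjective p := by
    intro y
    obtain ⟨m, rfl⟩ := Submodule.mkQ_surjective _ y
    obtain ⟨u, rfl⟩ := hπ m
    exact ⟨Submodule.Quotient.mk u, rfl⟩
  let p' : ((Fin n → R) ⧸ (J • ⊤ : Submodule R (Fin n → R))) →ₗ[R ⧸ J]
      (M ⧸ (J • ⊤ : Submodule R M)) :=
    { p with
      map_smul' := by
        intro r x
        obtain ⟨r, rfl⟩ := Ideal.Quotient.mk_surjective r
        exact p.map_smul r x }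
  obtain ⟨s, hs⟩ := Module.projective_lifting_property p' LinearMap.id hp
  have hs' : ∀ y, p (s y) = y := fun y => LinearMap.congr_fun hs y
  -- a map `G` into the kernel, congruent to the identity on the kernel modulo `J`
  have key : ∀ u : Fin n → R, ∃ g : Fin n → R, π g = 0 ∧
      (J • ⊤ : Submodule R (Fin n → R)).mkQ g =
        (J • ⊤ : Submodule R (Fin n → R)).mkQ u - s (p (Submodule.mkQ _ u)) := by
    intro u
    obtain ⟨v, hv⟩ := Submodule.mkQ_surjective _
      ((J • ⊤ : Submodule R (Fin n → R)).mkQ u - s (p (Submodule.mkQ _ u)))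
    have h1 : p (Submodule.mkQ _ v) = 0 := by
      rw [hv, map_sub, hs', sub_self]
    have h2 : π v ∈ (J • ⊤ : Submodule R M) := (Submodule.Quotient.mk_eq_zero _).1 h1
    rw [← hmap] at h2
    obtain ⟨c, hc, hcv⟩ := h2
    refine ⟨v - c, by rw [map_sub, hcv, sub_self], ?_⟩
    have hc0 : (J • ⊤ : Submodule R (Fin n → R)).mkQ c = 0 :=
      (Submodule.Quotient.mk_eq_zero _).2 hc
    rw [map_sub, hc0, sub_zero, hv]
  choose g hg0 hg1 using key
  let b := Pi.basisFun R (Fin n)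
  let G : (Fin n → R) →ₗ[R] (Fin n → R) := b.constr R (fun i => g (b i))
  have hGb : ∀ i, G (b i) = g (b i) := fun i => b.constr_basis R _ i
  have hG0 : π ∘ₗ G = 0 := b.ext fun i => by
    rw [LinearMap.comp_apply, hGb, hg0, LinearMap.zero_apply]
  have hp0 : ∀ r : R, ∀ y, s (r • y) = r • s y := fun r y =>
    s.map_smul (Ideal.Quotient.mk J r) y
  let s' : (M ⧸ (J • ⊤ : Submodule R M)) →ₗ[R]
      ((Fin n → R) ⧸ (J • ⊤ : Submodule R (Fin n → R))) :=
    { toFun := s, map_add' := s.map_add, map_smul' := hp0 }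
  have hG1 : (J • ⊤ : Submodule R (Fin n → R)).mkQ ∘ₗ G =
      (J • ⊤ : Submodule R (Fin n → R)).mkQ - s' ∘ₗ p ∘ₗ Submodule.mkQ _ :=
    b.ext fun i => by
      rw [LinearMap.comp_apply, hGb, hg1]; rfl
  have hGK : ∀ x, π x = 0 → x - G x ∈ (J • ⊤ : Submodule R (Fin n → R)) := by
    intro x hx
    have h1 := LinearMap.congr_fun hG1 x
    have h2 : p (Submodule.mkQ _ x) = 0 := by
      change Submodule.Quotient.mk (π x) = 0
      rw [hx, Submodule.Quotient.mk_zero]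
    rw [LinearMap.sub_apply, LinearMap.comp_apply, LinearMap.comp_apply, LinearMap.comp_apply,
      h2, map_zero, sub_zero] at h1
    exact (Submodule.Quotient.eq _).1 h1.symm
  have hker : LinearMap.ker π = LinearMap.range G := by
    apply le_antisymm
    · intro x hx
      rw [LinearMap.mem_ker] at hx
      have hf : π ∘ₗ (G.coprod (LinearMap.toSpanSingleton R _ x)) = 0 := by
        ext1
        · rw [LinearMap.comp_assoc, LinearMap.coprod_inl, hG0, LinearMap.zero_comp]
        · ext; simp [hx]
      obtain ⟨k, a, y, hya, haf⟩ := Module.Flat.exists_factorization_of_comp_eq_zero_of_free hf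
      obtain ⟨y', hy'⟩ := Module.projective_lifting_property π y hπ
      have haG : ∀ u, a (G u) = 0 := fun u => by
        simpa using LinearMap.congr_fun haf (u, 0)
      have hax : a x = 0 := by
        simpa using LinearMap.congr_fun haf (0, 1)
      let A := y' ∘ₗ a
      have hπA : ∀ u, π (A u) = π u := fun u => by
        have h1 : π (y' (a u)) = y (a u) := LinearMap.congr_fun hy' (a u)
        have h2 : π u = y (a u) := LinearMap.congr_fun hya u
        exact h1.trans h2.symm
      have hAG : ∀ u, A (G u) = 0 := fun u => by
        change y' (a (G u)) = 0
        rw [haG, map_zero]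
      have htop : (⊤ : Submodule R (Fin n → R)) ≤ LinearMap.range G ⊔ LinearMap.range A := by
        apply Submodule.le_of_le_smul_of_le_jacobson_bot Module.Finite.fg_top hJ
        intro u _
        have h1 := hGK (u - A u) (by rw [map_sub, hπA, sub_self])
        have h2 : u = (G (u - A u) + A u) + ((u - A u) - G (u - A u)) := by abel
        rw [h2]
        exact Submodule.add_mem_sup (Submodule.add_mem_sup ⟨_, rfl⟩ ⟨_, rfl⟩) h1
      let B := (LinearMap.range G).mapQ (LinearMap.range G) A (by
        rintro _ ⟨u, rfl⟩
        rw [Submodule.mem_comap, hAG]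
        exact Submodule.zero_mem _)
      have hB : Function.Surjective B := by
        intro z
        obtain ⟨u, rfl⟩ := Submodule.mkQ_surjective _ z
        obtain ⟨_, ⟨v, rfl⟩, _, ⟨w, rfl⟩, hvw⟩ := Submodule.mem_sup.1 (htop (x := u) trivial)
        refine ⟨Submodule.Quotient.mk w, ?_⟩
        change Submodule.Quotient.mk (A w) = Submodule.Quotient.mk u
        rw [eq_comm, Submodule.Quotient.eq, ← hvw, add_sub_cancel_right]
        exact ⟨v, rfl⟩
      have hinj := OrzechProperty.injective_of_surjective_endomorphism B hB
      rw [← Submodule.Quotient.mk_eq_zero]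
      apply hinj
      rw [map_zero]
      change Submodule.Quotient.mk (y' (a x)) = 0
      rw [hax, map_zero, Submodule.Quotient.mk_zero]
    · rintro _ ⟨u, rfl⟩
      exact LinearMap.congr_fun hG0 u
  have := Module.finitePresentation_of_free_of_surjective π hπ (by
    rw [hker]; exact Submodule.fg_range _)
  exact Module.Flat.projective_of_finitePresentation
end

section
/- Let \phi: A \to B be a homomorphism of commutative rings whose kernel is contained in the Jacobson radical of A. If M is a finitely generated flat A-module such that M \otimes_A B is B-projective, then M is A-projective. -/
open TensorProduct


lemma aux_theta {A M F : Type*} [CommRing A] [AddCommGroup M] [Module A M] [Module.Flat A M]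
    [AddCommGroup F] [Module A F] [Module.Free A F] [Module.Finite A F] (π : F →ₗ[A] M)
    (hπ : Function.Surjective π) (N : Submodule A F) (hN : N.FG) (hNK : N ≤ LinearMap.ker π) :
    ∃ θ : F →ₗ[A] F, (∀ x, θ x ∈ LinearMap.ker π) ∧ ∀ x ∈ N, θ x = x := by
  have : Module.Finite A N := .of_fg hN
  have h : π ∘ₗ N.subtype = 0 := by
    ext x; exact hNK x.2
  obtain ⟨k, a, y, hya, haf⟩ := Module.Flat.exists_factorization_of_comp_eq_zero_of_free h
  obtain ⟨b, hb⟩ := Module.projective_lifting_property π y hπ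
  refine ⟨LinearMap.id - b ∘ₗ a, fun x ↦ ?_, fun x hx ↦ ?_⟩
  · have h1 : π (b (a x)) = y (a x) := LinearMap.congr_fun hb _
    have h2 : π x = y (a x) := LinearMap.congr_fun hya x
    simp [h1, h2]
  · have : a x = 0 := LinearMap.congr_fun haf ⟨x, hx⟩
    simp [this]

lemma aux_ker {A M F : Type*} (C : Type*) [CommRing A] [CommRing C] [Algebra A C]
    [AddCommGroup M] [Module A M]
    [AddCommGroup F] [Module A F] [Module.Free A F] [Module.Finite A F] (π : F →ₗ[A] M)
    (hπ : Function.Surjective π) [Module.Projective C (C ⊗[A] M)] :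
    ((LinearMap.ker π).baseChange C).FG := by
  have : Module.Finite A M := .of_surjective π hπ
  have := Module.finitePresentation_of_projective C (C ⊗[A] M)
  have h := Module.FinitePresentation.fg_ker (π.baseChange C) (LinearMap.lTensor_surjective C hπ)
  have h2 : Function.Exact ((LinearMap.ker π).subtype.baseChange C) (π.baseChange C) :=
    lTensor_exact C π.exact_subtype_ker_map hπ
  rwa [h2.linearMap_ker_eq] at h

lemma aux_fin {A F : Type*} (C : Type*) [CommRing A] [CommRing C] [Algebra A C]
    [AddCommGroup F] [Module A F] (K : Submodule A F) (h : (K.baseChange C).FG) :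
    ∃ N : Submodule A F, N.FG ∧ N ≤ K ∧ K.baseChange C ≤ N.baseChange C := by
  obtain ⟨s, hs⟩ := h
  have key : ∀ z ∈ K.baseChange C, ∃ N : Submodule A F, N.FG ∧ N ≤ K ∧ z ∈ N.baseChange C := by
    rintro _ ⟨z, rfl⟩
    induction z with
    | zero => exact ⟨⊥, Submodule.fg_bot, bot_le, by simp⟩
    | tmul c x =>
      exact ⟨A ∙ (x : F), Submodule.fg_span_singleton _, by simp,
        Submodule.tmul_mem_baseChange_of_mem c (Submodule.mem_span_singleton_self _)⟩
    | add x y hx hy =>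
      obtain ⟨N, h1, h2, h3⟩ := hx
      obtain ⟨N', h1', h2', h3'⟩ := hy
      refine ⟨N ⊔ N', h1.sup h1', sup_le h2 h2', ?_⟩
      rw [map_add]
      exact add_mem (Submodule.baseChange_mono C le_sup_left h3)
        (Submodule.baseChange_mono C le_sup_right h3')
  choose! N h1 h2 h3 using key
  have hsK : ∀ z ∈ s, z ∈ K.baseChange C := fun z hz ↦ hs ▸ Submodule.subset_span hz
  refine ⟨s.sup N, Submodule.fg_finset_sup s _ fun z hz ↦ h1 z (hsK z hz),
    Finset.sup_le fun z hz ↦ h2 z (hsK z hz), ?_⟩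
  rw [← hs, Submodule.span_le]
  intro z hz
  exact Submodule.baseChange_mono C (Finset.le_sup hz) (h3 z (hsK z hz))

lemma aux_coord {A B : Type*} [CommRing A] [CommRing B] [Algebra A B] {n : ℕ} (x : Fin n → A)
    (h : (1 : B) ⊗ₜ[A] x = 0) (i : Fin n) : x i ∈ RingHom.ker (algebraMap A B) := by
  have := congrArg (TensorProduct.piScalarRight A B B (Fin n)) h
  have := congrFun this i
  simpa [Algebra.smul_def] using this

/-- If `φ : A → B` has kernel contained in the Jacobson radical of `A` and `M` is
a finitely generated flat `A`-module with `M ⊗_A B` projective over `B`, then `M`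
is projective over `A`. -/
theorem projective_of_baseChange_projective_of_ker_le_jacobson
    (A B M : Type*) [CommRing A] [CommRing B] [Algebra A B]
    (hker : RingHom.ker (algebraMap A B) ≤ Ideal.jacobson ⊥)
    [AddCommGroup M] [Module A M] [Module.Finite A M] [Module.Flat A M]
    (hproj : Module.Projective B (B ⊗[A] M)) :
    Module.Projective A M := by

  obtain ⟨n, π, hπ⟩ := Module.Finite.exists_fin' A M
  set K := LinearMap.ker π with hK
  set I := RingHom.ker (algebraMap A B) with hI
  obtain ⟨N, hN1, hN2, hN3⟩ := aux_fin B K (aux_ker B π hπ)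
  obtain ⟨θ, hθ1, hθ2⟩ := aux_theta π hπ N hN1 hN2
  have hfix : ∀ z ∈ N.baseChange B, θ.baseChange B z = z := by
    rintro _ ⟨z, rfl⟩
    induction z with
    | zero => simp
    | tmul c x => simp [hθ2 x x.2]
    | add x y hx hy => rw [map_add, map_add, hx, hy]
  have hdiff : ∀ x ∈ K, x - θ x ∈ I • K := by
    intro x hx
    have h1 := hfix _ (hN3 (Submodule.tmul_mem_baseChange_of_mem (1 : B) hx))
    rw [LinearMap.baseChange_tmul] at h1
    have h2 : (1 : B) ⊗ₜ[A] (x - θ x) = 0 := by rw [TensorProduct.tmul_sub, h1, sub_self]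
    have h3 := aux_coord _ h2
    obtain ⟨θ', ht1, ht2⟩ := aux_theta π hπ (A ∙ (x - θ x)) (Submodule.fg_span_singleton _)
      (by rw [Submodule.span_singleton_le_iff_mem]; exact sub_mem hx (hθ1 x))
    rw [← ht2 (x - θ x) (Submodule.mem_span_singleton_self _)]
    rw [pi_eq_sum_univ' (x - θ x), map_sum]
    refine sum_mem fun i _ ↦ ?_
    rw [map_smul]
    exact Submodule.smul_mem_smul (h3 i) (ht1 _)
  have hle : K ≤ LinearMap.range θ := by
    intro x hx
    refine Submodule.mem_of_localization_maximal
      (fun P [P.IsMaximal] ↦ Localization.AtPrime P ⊗[A] (Fin n → A))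
      (fun P _ ↦ TensorProduct.mk A (Localization.AtPrime P) (Fin n → A) 1) x _ fun P hP ↦ ?_
    let C := Localization.AtPrime P
    have : Module.Free C (C ⊗[A] M) := Module.free_of_flat_of_isLocalRing
    have hfg : (K.baseChange C).FG := aux_ker C π hπ
    have hnak : K.baseChange C ≤ (LinearMap.range θ).baseChange C := by
      refine Submodule.le_of_le_smul_of_le_jacobson_bot hfg
        (IsLocalRing.maximalIdeal_le_jacobson _) ?_
      rw [Submodule.baseChange_eq_span, Submodule.span_le]
      rintro _ ⟨y, hy, rfl⟩
      have hy' : y = θ y + (y - θ y) := by abel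
      rw [hy', map_add]
      refine Submodule.add_mem_sup (Submodule.tmul_mem_baseChange_of_mem _ ⟨y, rfl⟩) ?_
      have := hdiff y hy
      generalize y - θ y = w at this
      induction this using Submodule.smul_induction_on' with
      | smul r hr k hk =>
        rw [map_smul, ← algebraMap_smul C r]
        refine Submodule.smul_mem_smul ?_ (Submodule.subset_span ⟨k, hk, rfl⟩)
        have : r ∈ P := by
          have := hker hr
          rw [Ideal.jacobson, Submodule.mem_sInf] at this
          exact this P ⟨bot_le, hP⟩
        exact (IsLocalization.AtPrime.to_map_mem_maximal_iff C P r).mpr this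
      | add a _ b _ ha hb => rw [map_add]; exact add_mem ha hb
    have hx' := hnak (Submodule.tmul_mem_baseChange_of_mem 1 hx)
    have : (LinearMap.range θ).baseChange C = (LinearMap.range θ).localized' C P.primeCompl
        (TensorProduct.mk A C (Fin n → A) 1) := by
      rw [Submodule.localized'_eq_span, Submodule.baseChange_eq_span]; rfl
    rw [this] at hx'
    exact hx'
  have heq : K = LinearMap.range θ := le_antisymm hle (by rintro _ ⟨y, rfl⟩; exact hθ1 y)
  have hKfg : K.FG := by rw [heq]; rw [LinearMap.range_eq_map]; exact Module.Finite.fg_top.map θ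
  have := Module.finitePresentation_of_surjective π hπ hKfg
  exact Module.Flat.projective_of_finitePresentation
end

section
/- Let \phi: A \to B be a homomorphism of commutative rings whose kernel is contained in the Jacobson radical of A. If every finitely generated flat B-module is projective, then every finitely generated flat A-module is projective. -/
universe u v w

open TensorProduct in
/-- Purity of the kernel of a map from a finite free module to a flat module. -/
lemma sRingAux_exists_fix {A : Type u} [CommRing A] {M : Type u} [AddCommGroup M] [Module A M]
    [Module.Flat A M] {n : ℕ} (f : (Fin n → A) →ₗ[A] M) (hf : Function.Surjective f)
    (s : Set (Fin n → A)) (hs : s.Finite) (hsf : ∀ k ∈ s, f k = 0) :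
    ∃ g : (Fin n → A) →ₗ[A] (Fin n → A), (∀ x, f (g x) = 0) ∧ ∀ k ∈ s, g k = k := by
  have : Module.Finite A (Submodule.span A s) := Module.Finite.span_of_finite A hs
  have h0 : f ∘ₗ (Submodule.span A s).subtype = 0 := by
    have : Submodule.span A s ≤ LinearMap.ker f := Submodule.span_le.2 hsf
    ext ⟨x, hx⟩
    exact this hx
  obtain ⟨k, a, y, hya, ha⟩ := Module.Flat.exists_factorization_of_comp_eq_zero_of_free h0
  obtain ⟨z, hz⟩ := Module.projective_lifting_property f y hf
  refine ⟨LinearMap.id - z ∘ₗ a, fun x => ?_, fun k hk => ?_⟩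
  · have h1 : f (z (a x)) = y (a x) := LinearMap.congr_fun hz (a x)
    have h2 : f x = y (a x) := LinearMap.congr_fun hya x
    simp [h1, h2]
  · have h1 : a k = 0 := LinearMap.congr_fun ha ⟨k, Submodule.subset_span hk⟩
    simp [h1]

open TensorProduct in
lemma sRingAux_ker_baseChange {A : Type u} {B : Type v} [CommRing A] [CommRing B] [Algebra A B]
    {M F : Type u} [AddCommGroup M] [Module A M] [AddCommGroup F] [Module A F]
    (f : F →ₗ[A] M) (hf : Function.Surjective f) :
    LinearMap.ker (f.baseChange B) =
      Submodule.span B ((fun x : F => (1 : B) ⊗ₜ[A] x) '' (LinearMap.ker f : Set F)) := by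
  apply le_antisymm
  · intro z hz
    have hex := lTensor_exact B (LinearMap.exact_subtype_ker_map f) hf
    obtain ⟨w, rfl⟩ := (hex z).1 hz
    clear hz
    induction w with
    | zero => simp
    | add x y hx hy => rw [map_add]; exact add_mem hx hy
    | tmul b k =>
      have : (LinearMap.lTensor B (LinearMap.ker f).subtype) (b ⊗ₜ k) =
          b • ((1 : B) ⊗ₜ[A] (k : F)) := by simp [TensorProduct.smul_tmul']
      rw [this]
      exact Submodule.smul_mem _ _ (Submodule.subset_span ⟨k, k.2, rfl⟩)
  · rw [Submodule.span_le]
    rintro _ ⟨k, hk, rfl⟩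
    have : f k = 0 := hk
    simp [this]

/-- If `φ : A → B` has kernel contained in the Jacobson radical of `A` and every
finitely generated flat `B`-module is projective, then every finitely generated
flat `A`-module is projective. -/
theorem sRing_of_ker_le_jacobson
    {A : Type u} {B : Type v} [CommRing A] [CommRing B] (φ : A →+* B)
    (hker : RingHom.ker φ ≤ Ideal.jacobson ⊥)
    (hB : ∀ (N : Type v) [AddCommGroup N] [Module B N],
      Module.Finite B N → Module.Flat B N → Module.Projective B N)
    (M : Type u) [AddCommGroup M] [Module A M]
    [Module.Finite A M] [Module.Flat A M] :
    Module.Projective A M := by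
  classical
  let _ : Algebra A B := φ.toAlgebra
  obtain ⟨n, f, hf⟩ := Module.Finite.exists_fin' A M
  -- the base change is projective
  have hproj : Module.Projective B (TensorProduct A B M) := by
    obtain ⟨m, g, hg⟩ := Module.Finite.exists_fin' B (TensorProduct A B M)
    let e := g.quotKerEquivOfSurjective hg
    have h1 : Module.Flat B ((Fin m → B) ⧸ LinearMap.ker g) := Module.Flat.of_linearEquiv e
    have h2 := hB ((Fin m → B) ⧸ LinearMap.ker g) inferInstance h1
    exact Module.Projective.of_equiv e
  have hfp : Module.FinitePresentation B (TensorProduct A B M) :=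
    Module.finitePresentation_of_projective _ _
  have hfB : Function.Surjective (f.baseChange B) := LinearMap.lTensor_surjective B hf
  have hfg : (LinearMap.ker (f.baseChange B)).FG := Module.FinitePresentation.fg_ker _ hfB
  have hkerB := sRingAux_ker_baseChange (B := B) f hf
  -- a finite set of generators coming from the kernel of `f`
  obtain ⟨s, hs, hsfin, hspan⟩ : ∃ s : Set (Fin n → A), s ⊆ LinearMap.ker f ∧ s.Finite ∧
      LinearMap.ker (f.baseChange B) =
        Submodule.span B ((fun x => TensorProduct.tmul A (1 : B) x) '' s) := by
    rw [hkerB] at hfg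
    obtain ⟨t, ht, hte⟩ := (Submodule.fg_span_iff_fg_span_finset_subset _).1 hfg
    obtain ⟨s, hs, hsfin, hst⟩ := t.finite_toSet.exists_subset_finite_image_eq ht
    exact ⟨s, hs, hsfin, by rw [hkerB, hte, hst]⟩
  obtain ⟨g, hg0, hgs⟩ := sRingAux_exists_fix f hf s hsfin hs
  -- `g` fixes the kernel modulo `ker φ`
  have hmod : ∀ k, f k = 0 → ∀ i, k i - g k i ∈ RingHom.ker φ := by
    intro k hk i
    have h1 : LinearMap.ker (f.baseChange B) ≤
        LinearMap.ker (LinearMap.id - g.baseChange B) := by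
      rw [hspan, Submodule.span_le]
      rintro _ ⟨x, hx, rfl⟩
      simp [hgs x hx]
    have h2 : TensorProduct.tmul A (1 : B) k ∈ LinearMap.ker (f.baseChange B) := by
      simp [hk]
    have h3 := h1 h2
    have h4 : TensorProduct.tmul A (1 : B) (k - g k) = 0 := by
      simpa [TensorProduct.tmul_sub] using h3
    have h5 := congrFun (congrArg (TensorProduct.piScalarRight A B B (Fin n)) h4) i
    simp [Algebra.smul_def] at h5
    rw [RingHom.mem_ker, map_sub]
    exact h5
  -- the kernel is the range of `g`
  have hrange : LinearMap.ker f = LinearMap.range g := by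
    apply le_antisymm
    · intro k hk
      obtain ⟨y, hy0, hys⟩ := sRingAux_exists_fix f hf
        (insert k (Set.range fun i => g (Pi.single i 1)))
        ((Set.finite_range _).insert k) (by
          rintro _ (rfl | ⟨i, rfl⟩)
          · exact hk
          · exact hg0 _)
      have hyk : y k = k := hys k (Set.mem_insert _ _)
      have hyg : y ∘ₗ g = g := by
        apply LinearMap.pi_ext'
        intro i
        ext1
        exact hys _ (Set.mem_insert_of_mem _ ⟨i, rfl⟩)
      have hyg' : ∀ x, y (g x) = g x := fun x => LinearMap.congr_fun hyg x
      let p : (Fin n → A) →ₗ[A] (Fin n → A) := LinearMap.id - (y - g ∘ₗ y)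
      have hpk : p k = g k := by simp [p, hyk]
      have hpg : ∀ x, p (g x) = g (g x) := fun x => by simp [p, hyg']
      have hdet : φ (LinearMap.det p) = 1 := by
        rw [← LinearMap.det_toMatrix', RingHom.map_det]
        have : φ.mapMatrix (LinearMap.toMatrix' p) = 1 := by
          ext i j
          have h := hmod (y (Pi.single j 1)) (hy0 _) i
          rw [RingHom.mem_ker] at h
          rw [RingHom.mapMatrix_apply, Matrix.map_apply, LinearMap.toMatrix'_apply]
          simp only [p, LinearMap.sub_apply, LinearMap.id_apply, LinearMap.comp_apply,
            Pi.sub_apply]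
          rw [map_sub, h, sub_zero, Matrix.one_apply, Pi.single_apply]
          split_ifs <;> simp
        rw [this, Matrix.det_one]
      have hunit : IsUnit (LinearMap.det p) := by
        have h1 : LinearMap.det p - 1 ∈ Ideal.jacobson (⊥ : Ideal A) :=
          hker (by rw [RingHom.mem_ker, map_sub, hdet, map_one, sub_self])
        have h2 := Ideal.mem_jacobson_bot.1 h1 1
        simpa using h2
      have hc : IsUnit (p.charpoly.coeff 0) := by
        rw [LinearMap.det_eq_sign_charpoly_coeff] at hunit
        exact isUnit_of_mul_isUnit_right hunit
      have hpow : ∀ q : Polynomial A, ∀ x ∈ LinearMap.range g,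
          Polynomial.aeval p q x ∈ LinearMap.range g := by
        intro q
        induction q using Polynomial.induction_on' with
        | add q r hq hr =>
          intro x hx
          rw [map_add]
          exact add_mem (hq x hx) (hr x hx)
        | monomial m a =>
          intro x hx
          rw [Polynomial.aeval_monomial, Module.algebraMap_end_eq_smul_id]
          refine Submodule.smul_mem _ a ?_
          induction m with
          | zero => simpa using hx
          | succ m ih =>
            obtain ⟨z, hz⟩ := ih
            rw [pow_succ']
            refine ⟨g z, ?_⟩
            rw [← hpg, hz]
            rfl
      have hCH := LinearMap.congr_fun p.aeval_self_charpoly k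
      rw [← Polynomial.divX_mul_X_add p.charpoly] at hCH
      simp only [map_add, map_mul, Polynomial.aeval_X, Polynomial.aeval_C,
        LinearMap.add_apply, Module.End.mul_apply, LinearMap.zero_apply, hpk,
        Module.algebraMap_end_apply] at hCH
      have h1 : p.charpoly.coeff 0 • k ∈ LinearMap.range g := by
        rw [eq_neg_of_add_eq_zero_right hCH]
        exact neg_mem (hpow _ _ ⟨k, rfl⟩)
      exact (Submodule.smul_mem_iff_of_isUnit _ hc).1 h1
    · rintro _ ⟨x, rfl⟩
      exact hg0 x
  have : Module.FinitePresentation A M :=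
    Module.finitePresentation_of_surjective f hf (hrange ▸ Submodule.fg_range g)
  exact Module.Flat.projective_of_finitePresentation
end
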